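/- Suppose α ∈ ℝ/ℤ is a Roth number (for every ε > 0 there is c(ε) > 0 with ⟨qα⟩ > c(ε)/q^{1+ε} for all q ∈ ℤ₊), and each interval of the finite interval partition J of ℝ/ℤ has length strictly less than 1/2. Then for every β, γ, the coding s of n ↦ αn² + βn + γ with respect to J satisfies R(s) = T(s) = 1. -/

import Mathlib

open scoped ENNReal

noncomputable def Rn {A : Type*} (ω : ℤ → A) (n : ℕ) : ℝ≥0∞ :=
  1 + (n : ℝ≥0∞)⁻¹ *
    sSup ((fun m : ℕ => (m : ℝ≥0∞)) ''
      {m : ℕ | ∀ k : ℕ, 1 ≤ k → k ≤ m → ω (k : ℤ) = ω ((k : ℤ) + n)})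

noncomputable def Tn {A : Type*} (ω : ℤ → A) (n : ℕ) : ℝ≥0∞ :=
  1 + (n : ℝ≥0∞)⁻¹ *
    sSup ((fun m : ℕ => (m : ℝ≥0∞)) ''
      {m : ℕ | ∀ k : ℕ, 1 ≤ k → k ≤ m →
        ω (k : ℤ) = ω ((k : ℤ) + n) ∧ ω ((n : ℤ) + 1 - k) = ω (1 - (k : ℤ))})

noncomputable def RRep {A : Type*} (ω : ℤ → A) : ℝ≥0∞ := Filter.atTop.limsup (Rn ω)

noncomputable def TRep {A : Type*} (ω : ℤ → A) : ℝ≥0∞ := Filter.atTop.limsup (Tn ω)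

/-- `⟨t⟩`, the distance from `t` to the nearest integer. -/
noncomputable def distInt (t : ℝ) : ℝ := |t - round t|


noncomputable def e1 (x : ℝ) : ℂ := Complex.exp ((2 * Real.pi * x : ℝ) * Complex.I)

lemma e1_add (x y : ℝ) : e1 (x + y) = e1 x * e1 y := by
  unfold e1
  rw [← Complex.exp_add]
  congr 1
  push_cast
  ring

lemma e1_norm (x : ℝ) : ‖e1 x‖ = 1 := Complex.norm_exp_ofReal_mul_I _

lemma e1_zero : e1 0 = 1 := by simp [e1]

lemma e1_conj (x : ℝ) : (starRingEnd ℂ) (e1 x) = e1 (-x) := by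
  unfold e1
  rw [← Complex.exp_conj]
  congr 1
  rw [map_mul, Complex.conj_ofReal, Complex.conj_I]
  push_cast
  ring

lemma e1_nat_mul (n : ℕ) (x : ℝ) : e1 (n * x) = e1 x ^ n := by
  unfold e1
  rw [← Complex.exp_nat_mul]
  congr 1
  push_cast
  ring

lemma distInt_le (x : ℝ) (k : ℤ) : distInt x ≤ |x - k| := round_le x k

lemma distInt_nonneg (x : ℝ) : 0 ≤ distInt x := abs_nonneg _

lemma distInt_le_half (x : ℝ) : distInt x ≤ 1 / 2 := abs_sub_round x

lemma distInt_neg (x : ℝ) : distInt (-x) = distInt x := by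
  apply le_antisymm
  · have h := distInt_le (-x) (-round x)
    refine h.trans_eq ?_
    unfold distInt
    rw [← abs_neg]
    congr 1
    push_cast
    ring
  · have h := distInt_le x (-round (-x))
    refine h.trans_eq ?_
    unfold distInt
    rw [← abs_neg]
    congr 1
    push_cast
    ring

lemma abs_sin_ge (x : ℝ) : 2 * distInt x ≤ |Real.sin (Real.pi * x)| := by
  have h1 : |Real.sin (Real.pi * x)| = |Real.sin (Real.pi * (x - round x))| := by
    have : Real.pi * (x - round x) = Real.pi * x - (round x : ℤ) * Real.pi := by ring
    rw [this, Real.sin_sub_int_mul_pi]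
    rw [abs_mul]
    simp
  have h2 : |Real.sin (Real.pi * (x - round x))| = |Real.sin (Real.pi * distInt x)| := by
    unfold distInt
    rcases abs_choice (x - round x) with h | h <;> rw [h]
    rw [mul_neg, Real.sin_neg, abs_neg]
  rw [h1, h2]
  have h0 := distInt_nonneg x
  have h3 := distInt_le_half x
  have hpi := Real.pi_pos
  have := Real.mul_le_sin (x := Real.pi * distInt x) (by positivity) (by nlinarith)
  have h4 : 2 / Real.pi * (Real.pi * distInt x) = 2 * distInt x := by field_simp
  rw [h4] at this
  exact this.trans (le_abs_self _)

lemma e1_sub_one_ge (x : ℝ) : 4 * distInt x ≤ ‖e1 x - 1‖ := by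
  have h := Complex.norm_exp_I_mul_ofReal_sub_one (2 * Real.pi * x)
  have h2 : e1 x = Complex.exp (Complex.I * ((2 * Real.pi * x : ℝ) : ℂ)) := by
    unfold e1; rw [mul_comm]
  rw [h2, h, Real.norm_eq_abs, abs_mul]
  have := abs_sin_ge x
  have h3 : 2 * Real.pi * x / 2 = Real.pi * x := by ring
  rw [h3, abs_of_pos (by norm_num : (0:ℝ) < 2)]
  linarith

lemma geom_bound (M : ℕ) (θ c X : ℝ) (hX : 0 < X) (h : X ≤ distInt θ) :
    ‖∑ j ∈ Finset.range M, e1 (θ * j + c)‖ ≤ 1 / (2 * X) := by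
  have h1 : ∑ j ∈ Finset.range M, e1 (θ * j + c) = (∑ j ∈ Finset.range M, e1 θ ^ j) * e1 c := by
    rw [Finset.sum_mul]
    refine Finset.sum_congr rfl fun j _ => ?_
    rw [e1_add, mul_comm θ, e1_nat_mul]
  have h2 := e1_sub_one_ge θ
  have h3 : 0 < ‖e1 θ - 1‖ := by linarith
  have hne : e1 θ ≠ 1 := by
    intro h; rw [h] at h3; simp at h3
  rw [h1, norm_mul, e1_norm, mul_one, geom_sum_eq hne, norm_div, div_le_div_iff₀ h3 (by positivity)]
  have h4 : ‖e1 θ ^ M - 1‖ ≤ 2 := by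
    refine (norm_sub_le _ _).trans ?_
    rw [norm_pow, e1_norm]; norm_num
  nlinarith

lemma tri_sum (f : ℕ → ℕ → ℝ) (L : ℕ) :
    ∑ i ∈ Finset.range L, ∑ j ∈ Finset.range i, f i j =
      ∑ r ∈ Finset.Ico 1 L, ∑ j ∈ Finset.range (L - r), f (j + r) j := by
  rw [Finset.sum_sigma', Finset.sum_sigma']
  refine Finset.sum_bij' (fun x _ => ⟨x.1 - x.2, x.2⟩) (fun x _ => ⟨x.2 + x.1, x.2⟩) ?_ ?_ ?_ ?_ ?_
  · rintro ⟨i, j⟩ h; simp at h ⊢; omega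
  · rintro ⟨i, j⟩ h; simp at h ⊢; omega
  · rintro ⟨i, j⟩ h; simp at h ⊢; omega
  · rintro ⟨i, j⟩ h; simp at h ⊢
  · rintro ⟨i, j⟩ h; simp at h ⊢
    congr 1; omega

lemma vdc (u : ℕ → ℂ) (hu : ∀ j, ‖u j‖ = 1) (L : ℕ) :
    ‖∑ j ∈ Finset.range L, u j‖ ^ 2 ≤ L + 2 * ∑ r ∈ Finset.Ico 1 L,
      ‖∑ j ∈ Finset.range (L - r), u (j + r) * (starRingEnd ℂ) (u j)‖ := by
  have key : ∀ L : ℕ, ‖∑ j ∈ Finset.range L, u j‖ ^ 2 =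
      L + 2 * ∑ i ∈ Finset.range L, ∑ j ∈ Finset.range i, (u i * (starRingEnd ℂ) (u j)).re := by
    intro L
    induction L with
    | zero => simp
    | succ L ih =>
      rw [Finset.sum_range_succ, Finset.sum_range_succ, mul_add, ← Complex.normSq_eq_norm_sq,
        Complex.normSq_add, Complex.normSq_eq_norm_sq, Complex.normSq_eq_norm_sq, ih, hu]
      have : ∑ j ∈ Finset.range L, (u L * (starRingEnd ℂ) (u j)).re
          = ((∑ j ∈ Finset.range L, u j) * (starRingEnd ℂ) (u L)).re := by
        rw [Finset.sum_mul, Complex.re_sum]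
        refine Finset.sum_congr rfl fun j _ => ?_
        simp only [Complex.mul_re, Complex.conj_re, Complex.conj_im]; ring
      rw [this]
      push_cast
      ring
  rw [key, tri_sum (fun i j => (u i * (starRingEnd ℂ) (u j)).re)]
  gcongr with r hr
  rw [← Complex.re_sum]
  exact Complex.re_le_norm _

lemma small_count (θ δ X : ℝ) (hδ : 0 < δ) (hX : 0 < X) (L : ℕ)
    (h : ∀ r : ℕ, 1 ≤ r → r < L → δ ≤ distInt (θ * r)) :
    (((Finset.Ico 1 L).filter (fun r : ℕ => distInt (θ * r) < X)).card : ℝ) ≤ 2 * X / δ + 2 := by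
  set S := (Finset.Ico 1 L).filter (fun r : ℕ => distInt (θ * r) < X)
  let x : ℕ → ℝ := fun r => θ * r - round (θ * r)
  have hsep : ∀ r r' : ℕ, r ∈ S → r' ∈ S → r < r' → δ ≤ |x r' - x r| := by
    intro r r' hr hr' hlt
    simp only [S, Finset.mem_filter, Finset.mem_Ico] at hr hr'
    have h1 := h (r' - r) (by omega) (by omega)
    have h2 := distInt_le (θ * ((r' - r : ℕ) : ℝ)) (round (θ * r') - round (θ * r))
    refine (h1.trans h2).trans_eq ?_
    congr 1
    push_cast [Nat.cast_sub hlt.le]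
    simp only [x]
    ring
  have hfl : ∀ a b : ℝ, ⌊a / δ⌋ = ⌊b / δ⌋ → |a - b| < δ := by
    intro a b hab
    have := Int.abs_sub_lt_one_of_floor_eq_floor hab
    rw [← sub_div, abs_div, abs_of_pos hδ, div_lt_one hδ] at this
    exact this
  have hcard : S.card ≤ (Finset.Icc ⌊-X / δ⌋ ⌊X / δ⌋).card := by
    apply Finset.card_le_card_of_injOn (fun r => ⌊x r / δ⌋)
    · intro r hr
      have hr2 : distInt (θ * r) < X := (Finset.mem_filter.mp hr).2
      have : |x r| < X := hr2
      rw [abs_lt] at this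
      simp only [Finset.coe_Icc, Set.mem_Icc]
      constructor
      · apply Int.floor_le_floor; gcongr; exact this.1.le
      · apply Int.floor_le_floor; gcongr; exact this.2.le
    · intro r hr r' hr' heq
      by_contra hne
      rcases lt_or_gt_of_ne hne with hlt | hlt
      · exact absurd (hfl _ _ heq.symm) (not_lt.mpr (hsep _ _ hr hr' hlt))
      · exact absurd (hfl _ _ heq) (not_lt.mpr (hsep _ _ hr' hr hlt))
  have h2 : (S.card : ℝ) ≤ ((Finset.Icc ⌊-X / δ⌋ ⌊X / δ⌋).card : ℝ) := by exact_mod_cast hcard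
  refine h2.trans ?_
  rw [Int.card_Icc]
  have h3 := Int.floor_le (X / δ)
  have h4 := Int.lt_floor_add_one (-X / δ)
  have h5 : ⌊-X / δ⌋ ≤ ⌊X / δ⌋ := by
    apply Int.floor_le_floor; gcongr; linarith
  have h6 : (((⌊X / δ⌋ + 1 - ⌊-X / δ⌋).toNat : ℤ) : ℝ) = ((⌊X / δ⌋ + 1 - ⌊-X / δ⌋ : ℤ) : ℝ) := by
    rw [Int.toNat_of_nonneg (by omega)]
  have h7 : (((⌊X / δ⌋ + 1 - ⌊-X / δ⌋).toNat : ℕ) : ℝ) = ((⌊X / δ⌋ + 1 - ⌊-X / δ⌋ : ℤ) : ℝ) := by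
    rw [← h6]; norm_cast
  rw [h7]
  push_cast
  have h8 : -X / δ = - (X / δ) := by ring
  have h9 : 2 * X / δ = 2 * (X / δ) := by ring
  rw [h8] at h4 ⊢
  rw [h9]
  linarith

lemma weyl (A B C δ X : ℝ) (hδ : 0 < δ) (hX : 0 < X) (L : ℕ)
    (h : ∀ r : ℕ, 1 ≤ r → r < L → δ ≤ distInt (2 * A * r)) :
    ‖∑ j ∈ Finset.range L, e1 (A * (j : ℝ) ^ 2 + B * j + C)‖ ^ 2 ≤
      L + 2 * (L * (2 * X / δ + 2) + L * (1 / (2 * X))) := by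
  refine (vdc (fun j : ℕ => e1 (A * (j : ℝ) ^ 2 + B * j + C)) (fun j => e1_norm _) L).trans ?_
  gcongr
  have hin : ∀ r ∈ Finset.Ico 1 L, ‖∑ j ∈ Finset.range (L - r),
      e1 (A * ((j + r : ℕ) : ℝ) ^ 2 + B * ((j + r : ℕ) : ℝ) + C) *
        (starRingEnd ℂ) (e1 (A * (j : ℝ) ^ 2 + B * j + C))‖ ≤
      (if distInt (2 * A * r) < X then (L : ℝ) else 0) + 1 / (2 * X) := by
    intro r hr
    have heq : ∀ j : ℕ, e1 (A * ((j + r : ℕ) : ℝ) ^ 2 + B * ((j + r : ℕ) : ℝ) + C) *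
        (starRingEnd ℂ) (e1 (A * (j : ℝ) ^ 2 + B * j + C)) =
        e1 ((2 * A * r) * j + (A * r ^ 2 + B * r)) := by
      intro j
      rw [e1_conj, ← e1_add]
      congr 1
      push_cast
      ring
    simp only [heq]
    split_ifs with hc
    · have : ‖∑ j ∈ Finset.range (L - r), e1 ((2 * A * r) * j + (A * r ^ 2 + B * r))‖ ≤ L := by
        refine (norm_sum_le _ _).trans ?_
        simp only [e1_norm, Finset.sum_const, Finset.card_range, nsmul_eq_mul, mul_one]
        exact_mod_cast Nat.sub_le _ _
      have : 0 ≤ 1 / (2 * X) := by positivity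
      linarith
    · rw [zero_add]
      exact geom_bound _ _ _ _ hX (not_lt.mp hc)
  refine (Finset.sum_le_sum hin).trans ?_
  rw [Finset.sum_add_distrib]
  gcongr ?_ + ?_
  · rw [← Finset.sum_filter, Finset.sum_const, nsmul_eq_mul, mul_comm]
    gcongr
    exact small_count (2 * A) δ X hδ hX L h
  · rw [Finset.sum_const, nsmul_eq_mul]
    gcongr
    simp

lemma cos_eq_e1 (x : ℝ) : ((Real.cos (Real.pi * x) : ℝ) : ℂ) = (e1 (x / 2) + e1 (-(x / 2))) / 2 := by
  rw [Complex.ofReal_cos, Complex.cos]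
  unfold e1
  congr 2
  · congr 1; push_cast; ring
  · congr 1; push_cast; ring

lemma kernel_expand (x : ℝ) (K : ℕ) :
    (((Real.cos (Real.pi * x) ^ 2) ^ K : ℝ) : ℂ) =
      ∑ i ∈ Finset.range (2 * K + 1),
        (((2 * K).choose i : ℝ) / 4 ^ K : ℝ) * e1 ((((i : ℤ) - K : ℤ) : ℝ) * x) := by
  rw [← pow_mul, Complex.ofReal_pow, cos_eq_e1, div_pow, add_pow, Finset.sum_div]
  refine Finset.sum_congr rfl fun i hi => ?_
  have hi' : i ≤ 2 * K := by simp at hi; omega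
  have h1 : e1 (x / 2) ^ i * e1 (-(x / 2)) ^ (2 * K - i) = e1 ((((i : ℤ) - K : ℤ) : ℝ) * x) := by
    rw [← e1_nat_mul, ← e1_nat_mul, ← e1_add]
    congr 1
    push_cast [Nat.cast_sub hi']
    ring
  rw [h1]
  have h2 : (2 : ℂ) ^ (2 * K) = 4 ^ K := by rw [pow_mul]; norm_num
  rw [h2]
  push_cast
  ring

lemma avoid (P : ℕ → ℝ) (L K : ℕ) (hK : 0 < K) (ρ E : ℝ) (hρ : 0 ≤ ρ)
    (hcos : ∀ j < L, Real.cos (Real.pi * P j) ^ 2 ≤ ρ) (hE0 : 0 ≤ E)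
    (hE : ∀ h : ℤ, h ≠ 0 → |h| ≤ K → ‖∑ j ∈ Finset.range L, e1 (h * P j)‖ ≤ E) :
    (L : ℝ) * (1 / (2 * K)) ≤ L * ρ ^ K + E := by
  have hsum : ((∑ j ∈ Finset.range L, (Real.cos (Real.pi * P j) ^ 2) ^ K : ℝ) : ℂ) =
      ∑ i ∈ Finset.range (2 * K + 1), (((2 * K).choose i : ℝ) / 4 ^ K : ℝ) *
        ∑ j ∈ Finset.range L, e1 ((((i : ℤ) - K : ℤ) : ℝ) * P j) := by
    rw [Complex.ofReal_sum]
    simp only [kernel_expand]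
    rw [Finset.sum_comm]
    simp only [Finset.mul_sum]
  have hle : ∑ j ∈ Finset.range L, (Real.cos (Real.pi * P j) ^ 2) ^ K ≤ L * ρ ^ K := by
    have : ∀ j ∈ Finset.range L, (Real.cos (Real.pi * P j) ^ 2) ^ K ≤ ρ ^ K := by
      intro j hj
      exact pow_le_pow_left₀ (by positivity) (hcos j (Finset.mem_range.mp hj)) K
    refine (Finset.sum_le_sum this).trans ?_
    simp
  have hnn : 0 ≤ ∑ j ∈ Finset.range L, (Real.cos (Real.pi * P j) ^ 2) ^ K :=
    Finset.sum_nonneg fun j _ => by positivity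
  have hKm : K ∈ Finset.range (2 * K + 1) := by simp; omega
  rw [← Finset.add_sum_erase _ _ hKm] at hsum
  have hmid : ∑ j ∈ Finset.range L, e1 ((((K : ℤ) - K : ℤ) : ℝ) * P j) = (L : ℂ) := by
    simp [e1_zero]
  rw [hmid] at hsum
  have herr : ‖∑ i ∈ (Finset.range (2 * K + 1)).erase K, (((2 * K).choose i : ℝ) / 4 ^ K : ℝ) *
        ∑ j ∈ Finset.range L, e1 ((((i : ℤ) - K : ℤ) : ℝ) * P j)‖ ≤ E := by
    refine (norm_sum_le _ _).trans ?_
    have h1 : ∀ i ∈ (Finset.range (2 * K + 1)).erase K,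
        ‖((((2 * K).choose i : ℝ) / 4 ^ K : ℝ) : ℂ) *
        ∑ j ∈ Finset.range L, e1 ((((i : ℤ) - K : ℤ) : ℝ) * P j)‖ ≤
          ((2 * K).choose i : ℝ) / 4 ^ K * E := by
      intro i hi
      simp only [Finset.mem_erase, Finset.mem_range] at hi
      rw [norm_mul, Complex.norm_real, Real.norm_of_nonneg (by positivity)]
      gcongr
      refine hE _ (by omega) ?_
      rw [abs_le]; omega
    refine (Finset.sum_le_sum h1).trans ?_
    refine (Finset.sum_le_sum_of_subset_of_nonneg (Finset.erase_subset _ _)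
      (fun i _ _ => by positivity)).trans ?_
    rw [← Finset.sum_mul, ← Finset.sum_div]
    have : (∑ i ∈ Finset.range (2 * K + 1), ((2 * K).choose i : ℝ)) = 4 ^ K := by
      have := Nat.sum_range_choose (2 * K)
      rw [pow_mul] at this
      exact_mod_cast this
    rw [this, div_self (by positivity), one_mul]
  have hmain : ((((2 * K).choose K : ℝ) / 4 ^ K : ℝ) * L : ℝ) ≤ L * ρ ^ K + E := by
    have h2 : (((((2 * K).choose K : ℝ) / 4 ^ K : ℝ) : ℂ) * L) =
        ((∑ j ∈ Finset.range L, (Real.cos (Real.pi * P j) ^ 2) ^ K : ℝ) : ℂ) -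
        ∑ i ∈ (Finset.range (2 * K + 1)).erase K, (((2 * K).choose i : ℝ) / 4 ^ K : ℝ) *
        ∑ j ∈ Finset.range L, e1 ((((i : ℤ) - K : ℤ) : ℝ) * P j) := by
      rw [hsum]; ring
    have h3 : ‖(((((2 * K).choose K : ℝ) / 4 ^ K : ℝ) : ℂ) * L)‖ = ((2 * K).choose K : ℝ) / 4 ^ K * L := by
      rw [norm_mul, Complex.norm_real, Real.norm_of_nonneg (by positivity), Complex.norm_natCast]
    rw [← h3, h2]
    refine (norm_sub_le _ _).trans ?_
    gcongr
    rw [Complex.norm_real, Real.norm_of_nonneg hnn]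
    exact hle
  refine le_trans ?_ hmain
  rw [mul_comm]
  refine mul_le_mul_of_nonneg_right ?_ (by positivity)
  have := Nat.four_pow_le_two_mul_self_mul_centralBinom K hK
  rw [Nat.centralBinom_eq_two_mul_choose] at this
  have h5 : (4 : ℝ) ^ K ≤ 2 * K * ((2 * K).choose K : ℝ) := by exact_mod_cast this
  have hK' : (0 : ℝ) < K := by exact_mod_cast hK
  rw [div_le_div_iff₀ (by positivity) (by positivity)]
  linarith

lemma roth_lower (α : ℝ)
    (hroth : ∀ ε : ℝ, 0 < ε → ∃ c : ℝ, 0 < c ∧ ∀ q : ℕ, 0 < q →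
      c / (q : ℝ) ^ ((1 : ℝ) + ε) < distInt ((q : ℝ) * α)) :
    ∃ M0 : ℕ, ∀ M : ℕ, M0 ≤ M → ∀ b : ℕ, 0 < b → b ≤ M ^ 44 →
      1 / (M : ℝ) ^ 46 ≤ distInt ((b : ℝ) * α) := by
  obtain ⟨c, hc, h⟩ := hroth (1 / 44) (by norm_num)
  obtain ⟨M0, hM0⟩ := exists_nat_gt (1 / c)
  refine ⟨M0, fun M hM b hb hbM => ?_⟩
  have hb' : (0 : ℝ) < b := by exact_mod_cast hb
  have hMc : 1 / c < M := hM0.trans_le (by exact_mod_cast hM)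
  have hMp : (0 : ℝ) < M := lt_trans (by positivity) hMc
  refine le_trans ?_ (h b hb).le
  have h1 : (b : ℝ) ^ ((1 : ℝ) + 1 / 44) ≤ (M : ℝ) ^ 45 := by
    have h2 : (b : ℝ) ≤ (M : ℝ) ^ 44 := by exact_mod_cast hbM
    refine (Real.rpow_le_rpow hb'.le h2 (by norm_num)).trans_eq ?_
    rw [← Real.rpow_natCast, ← Real.rpow_natCast, ← Real.rpow_mul hMp.le]
    norm_num
  have h3 : c / (M : ℝ) ^ 45 ≤ c / (b : ℝ) ^ ((1 : ℝ) + 1 / 44) := by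
    gcongr
  refine le_trans ?_ h3
  rw [div_le_div_iff₀ (by positivity) (by positivity)]
  rw [div_lt_iff₀ hc] at hMc
  have : (0 : ℝ) < (M : ℝ) ^ 45 := by positivity
  nlinarith

lemma density (α : ℝ)
    (hroth : ∀ ε : ℝ, 0 < ε → ∃ c : ℝ, 0 < c ∧ ∀ q : ℕ, 0 < q →
      c / (q : ℝ) ^ ((1 : ℝ) + ε) < distInt ((q : ℝ) * α)) (Q : ℕ) :
    ∃ M0 : ℕ, ∀ M : ℕ, M0 ≤ M → ∀ q : ℕ, 0 < q → q ≤ Q → ∀ B C : ℝ,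
      ∃ j < M ^ 40, Int.fract (α * q ^ 2 * (j : ℝ) ^ 2 + B * j + C) < 1 / M := by
  obtain ⟨M0, hM0⟩ := roth_lower α hroth
  refine ⟨max M0 (max 100 (2 * Q ^ 2)), fun M hM q hq hqQ B C => ?_⟩
  have hM1 : M0 ≤ M := le_trans (le_max_left _ _) hM
  have hM2 : 100 ≤ M := le_trans (le_trans (le_max_left _ _) (le_max_right _ _)) hM
  have hM3 : 2 * Q ^ 2 ≤ M := le_trans (le_trans (le_max_right _ _) (le_max_right _ _)) hM
  have hMr : (100 : ℝ) ≤ M := by exact_mod_cast hM2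
  have hMp : (0 : ℝ) < M := by linarith
  by_contra hcon
  push Not at hcon
  set P : ℕ → ℝ := fun j => α * q ^ 2 * (j : ℝ) ^ 2 + B * j + (C - 1 / (2 * M)) with hP
  have hdist : ∀ j < M ^ 40, 1 / (2 * M) ≤ distInt (P j) := by
    intro j hj
    have h1 := hcon j hj
    set x := α * q ^ 2 * (j : ℝ) ^ 2 + B * j + C with hx
    have hPx : P j = x - 1 / (2 * M) := by simp only [hP, hx]; ring
    have hw : (1 : ℝ) / M = 2 * (1 / (2 * M)) := by field_simp
    rw [hPx]
    unfold distInt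
    set k := round (x - 1 / (2 * (M : ℝ)))
    rw [hw] at h1
    have hwp : (0 : ℝ) < 1 / (2 * M) := by positivity
    set w := (1 : ℝ) / (2 * M)
    have hf := Int.floor_add_fract x
    have hf1 := Int.fract_lt_one x
    rcases le_or_gt k ⌊x⌋ with hk | hk
    · have hk' : (k : ℝ) ≤ ⌊x⌋ := by exact_mod_cast hk
      refine le_trans ?_ (le_abs_self _)
      linarith
    · have hk' : (⌊x⌋ : ℝ) + 1 ≤ k := by exact_mod_cast hk
      refine le_trans ?_ (neg_le_abs _)
      linarith
  have hcos : ∀ j < M ^ 40, Real.cos (Real.pi * P j) ^ 2 ≤ 1 - 1 / (M : ℝ) ^ 2 := by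
    intro j hj
    have h1 := hdist j hj
    have h2 := abs_sin_ge (P j)
    have h3 : 1 / (M : ℝ) ≤ |Real.sin (Real.pi * P j)| := by
      refine le_trans ?_ h2
      refine le_trans (le_of_eq ?_) (mul_le_mul_of_nonneg_left h1 (by norm_num))
      field_simp
    have h4 : (1 / (M : ℝ)) ^ 2 ≤ Real.sin (Real.pi * P j) ^ 2 := by
      rw [← sq_abs (Real.sin _)]
      exact pow_le_pow_left₀ (by positivity) h3 2
    have h5 := Real.sin_sq_add_cos_sq (Real.pi * P j)
    rw [div_pow, one_pow] at h4
    linarith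
  have hρ : (0 : ℝ) ≤ 1 - 1 / (M : ℝ) ^ 2 := by
    rw [sub_nonneg, div_le_one (by positivity)]
    nlinarith
  have hE : ∀ h : ℤ, h ≠ 0 → |h| ≤ (M ^ 3 : ℕ) →
      ‖∑ j ∈ Finset.range (M ^ 40), e1 (h * P j)‖ ≤ (M : ℝ) ^ 40 / (4 * (M : ℝ) ^ 3) := by
    intro h hh0 hhK
    have hrew : ∀ j : ℕ, (h : ℝ) * P j =
        (h * (α * q ^ 2)) * (j : ℝ) ^ 2 + (h * B) * j + h * (C - 1 / (2 * M)) := by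
      intro j; simp only [hP]; ring
    simp only [hrew]
    have hw := weyl (h * (α * q ^ 2)) (h * B) (h * (C - 1 / (2 * M))) (1 / (M : ℝ) ^ 46)
      (1 / (M : ℝ) ^ 20) (by positivity) (by positivity) (M ^ 40) (by
        intro r hr1 hr2
        have hb : 0 < 2 * q ^ 2 * h.natAbs * r := by
          have := Int.natAbs_pos.mpr hh0
          positivity
        have hb2 : 2 * q ^ 2 * h.natAbs * r ≤ M ^ 44 := by
          have e1 : h.natAbs ≤ M ^ 3 := by zify; exact_mod_cast hhK
          have e2 : 2 * q ^ 2 ≤ M := le_trans (by gcongr) hM3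
          calc 2 * q ^ 2 * h.natAbs * r ≤ M * M ^ 3 * M ^ 40 := by gcongr
            _ = M ^ 44 := by ring
        have h1 := hM0 M hM1 _ hb hb2
        refine h1.trans_eq ?_
        rcases Int.natAbs_eq h with hs | hs
        · congr 1
          have : (h : ℝ) = (h.natAbs : ℝ) := by
            conv_lhs => rw [hs]
            simp
          rw [this]; push_cast; ring
        · rw [← distInt_neg]
          congr 1
          have : (h : ℝ) = -(h.natAbs : ℝ) := by
            conv_lhs => rw [hs]
            simp
          rw [this]; push_cast; ring)
    refine (sq_le_sq₀ (norm_nonneg _) (by positivity)).mp (hw.trans ?_)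
    have e1 : 2 * (1 / (M : ℝ) ^ 20) / (1 / (M : ℝ) ^ 46) = 2 * (M : ℝ) ^ 26 := by field_simp
    have e2 : 1 / (2 * (1 / (M : ℝ) ^ 20)) = (M : ℝ) ^ 20 / 2 := by field_simp
    have e3 : ((M : ℝ) ^ 40 / (4 * (M : ℝ) ^ 3)) ^ 2 = (M : ℝ) ^ 40 * ((M : ℝ) ^ 34 / 16) := by
      field_simp; ring
    rw [e1, e2, e3]
    push_cast
    have e4 : (M : ℝ) ^ 40 + 2 * ((M : ℝ) ^ 40 * (2 * (M : ℝ) ^ 26 + 2) + (M : ℝ) ^ 40 * ((M : ℝ) ^ 20 / 2))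
      = (M : ℝ) ^ 40 * (5 + 4 * (M : ℝ) ^ 26 + (M : ℝ) ^ 20) := by ring
    rw [e4]
    gcongr
    have f1 : (1 : ℝ) ≤ (M : ℝ) ^ 20 := one_le_pow₀ (by linarith)
    have f2 : (M : ℝ) ^ 20 ≤ (M : ℝ) ^ 26 := pow_le_pow_right₀ (by linarith) (by norm_num)
    have f3 : (100 : ℝ) ^ 8 ≤ (M : ℝ) ^ 8 := pow_le_pow_left₀ (by norm_num) hMr 8
    have f4 : (M : ℝ) ^ 34 = (M : ℝ) ^ 26 * (M : ℝ) ^ 8 := by ring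
    have f5 : (160 : ℝ) ≤ (M : ℝ) ^ 8 := le_trans (by norm_num) f3
    rw [f4]
    have f6 : (M : ℝ) ^ 26 * 160 ≤ (M : ℝ) ^ 26 * (M : ℝ) ^ 8 := by gcongr
    linarith
  have hfin := avoid P (M ^ 40) (M ^ 3) (by positivity) _ _ hρ hcos (by positivity) hE
  have hexp : (1 - 1 / (M : ℝ) ^ 2) ^ (M ^ 3) < 1 / (4 * (M : ℝ) ^ 3) := by
    have g1 : (1 - 1 / (M : ℝ) ^ 2) ≤ Real.exp (-(1 / (M : ℝ) ^ 2)) := by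
      have := Real.add_one_le_exp (-(1 / (M : ℝ) ^ 2))
      linarith
    have g2 : (1 - 1 / (M : ℝ) ^ 2) ^ (M ^ 3) ≤ Real.exp (-M) := by
      refine (pow_le_pow_left₀ hρ g1 _).trans_eq ?_
      rw [← Real.exp_nat_mul]
      congr 1
      push_cast
      field_simp
    refine g2.trans_lt ?_
    rw [Real.exp_neg, ← one_div]
    apply one_div_lt_one_div_of_lt (by positivity)
    have g3 := Real.pow_div_factorial_le_exp (M : ℝ) hMp.le 4
    refine lt_of_lt_of_le ?_ g3
    rw [lt_div_iff₀ (by positivity)]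
    have : ((Nat.factorial 4 : ℕ) : ℝ) = 24 := by norm_num [Nat.factorial]
    rw [this]
    have : (0 : ℝ) < (M : ℝ) ^ 3 := by positivity
    nlinarith
  push_cast at hfin
  have hLp : (0 : ℝ) < (M : ℝ) ^ 40 := by positivity
  have k1 := mul_lt_mul_of_pos_left hexp hLp
  have k2 : (M : ℝ) ^ 40 * (1 / (2 * (M : ℝ) ^ 3)) = 2 * ((M : ℝ) ^ 40 / (4 * (M : ℝ) ^ 3)) := by
    field_simp; ring
  have k3 : (M : ℝ) ^ 40 * (1 / (4 * (M : ℝ) ^ 3)) = (M : ℝ) ^ 40 / (4 * (M : ℝ) ^ 3) := by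
    field_simp
  rw [k2] at hfin
  rw [k3] at k1
  linarith

lemma asym (c δ : ℝ) (hc : 0 < c) (hδ : 0 < δ) (Q M0 : ℕ) (hQ : 0 < Q) :
    ∃ n0 : ℕ, ∀ n : ℕ, n0 ≤ n → 0 < n ∧ ∃ M D : ℕ, M0 ≤ M ∧ 0 < M ∧ M ^ 40 ≤ D ∧
      1 + 4 * Q * (D : ℝ) ≤ δ * n ∧
      ∀ q : ℕ, 0 < q → q ≤ Q →
        1 / (M : ℝ) ≤ D * (c / ((2 * n * q : ℕ) : ℝ) ^ ((1 : ℝ) + 1 / 100)) := by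
  have hQr : (0 : ℝ) < Q := by exact_mod_cast hQ
  set c1 : ℝ := δ / (16 * Q) * (c / (2 * Q : ℝ) ^ ((1 : ℝ) + 1 / 100)) with hc1
  have hc1p : 0 < c1 := by positivity
  set T : ℝ := 1 + M0 + 2 ^ 40 * (16 * Q / δ) + 1 / c1 + 2 / δ with hT
  have htend : Filter.Tendsto (fun n : ℕ => (n : ℝ) ^ ((1 : ℝ) / 100)) Filter.atTop Filter.atTop :=
    (tendsto_rpow_atTop (by norm_num)).comp tendsto_natCast_atTop_atTop
  obtain ⟨n0, hn0⟩ := Filter.eventually_atTop.mp (htend.eventually_ge_atTop T)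
  refine ⟨n0 + 1, fun n hn => ⟨by omega, ?_⟩⟩
  have hy := hn0 n (by omega)
  set y : ℝ := (n : ℝ) ^ ((1 : ℝ) / 100) with hydef
  have hnp : (0 : ℝ) < n := by exact_mod_cast (by omega : 0 < n)
  have hyn : y ^ 100 = n := by
    rw [hydef, ← Real.rpow_natCast, ← Real.rpow_mul hnp.le]; norm_num
  have t1 : (0 : ℝ) ≤ M0 := by positivity
  have t2 : (0 : ℝ) < 2 ^ 40 * (16 * Q / δ) := by positivity
  have t3 : (0 : ℝ) < 1 / c1 := by positivity
  have t4 : (0 : ℝ) < 2 / δ := by positivity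
  have hy1 : 1 ≤ y := by linarith
  have hyp : 0 < y := by linarith
  have hyM : (M0 : ℝ) ≤ y := by linarith
  have hyQ : 2 ^ 40 * (16 * Q / δ) ≤ y := by linarith
  have hyc : 1 / c1 ≤ y := by linarith
  have hyd : 2 / δ ≤ y := by linarith
  have hpow : ∀ k : ℕ, k ≠ 0 → y ≤ y ^ k := fun k hk => le_self_pow₀ hy1 hk
  have hMl : y ^ 2 ≤ (⌈y ^ 2⌉₊ : ℝ) := Nat.le_ceil _
  have hMu : (⌈y ^ 2⌉₊ : ℝ) ≤ 2 * y ^ 2 := by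
    have h1 := Nat.ceil_lt_add_one (a := y ^ 2) (by positivity)
    have h2 : 1 ≤ y ^ 2 := one_le_pow₀ hy1
    linarith
  have hDu : (⌊δ * n / (8 * Q)⌋₊ : ℝ) ≤ δ * n / (8 * Q) := Nat.floor_le (by positivity)
  have hny : y ≤ n := by rw [← hyn]; exact hpow _ (by norm_num)
  have hDl : δ * n / (16 * Q) ≤ (⌊δ * n / (8 * Q)⌋₊ : ℝ) := by
    have h1 := Nat.lt_floor_add_one (δ * n / (8 * Q))
    have h2 : δ * n / (8 * Q) = 2 * (δ * n / (16 * Q)) := by field_simp; norm_num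
    have h3 : 1 ≤ δ * n / (16 * Q) := by
      rw [le_div_iff₀ (by positivity)]
      have h4 : 16 * Q / δ ≤ n := by
        have : 0 < 16 * Q / δ := by positivity
        linarith
      rw [div_le_iff₀ hδ] at h4
      linarith
    rw [h2] at h1 ⊢
    linarith
  refine ⟨⌈y ^ 2⌉₊, ⌊δ * n / (8 * Q)⌋₊, ?_, ?_, ?_, ?_, ?_⟩
  · have : (M0 : ℝ) ≤ (⌈y ^ 2⌉₊ : ℝ) := hyM.trans ((hpow 2 (by norm_num)).trans hMl)
    exact_mod_cast this
  · exact Nat.ceil_pos.mpr (by positivity)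
  · have : (⌈y ^ 2⌉₊ : ℝ) ^ 40 ≤ (⌊δ * n / (8 * Q)⌋₊ : ℝ) := by
      refine le_trans ?_ hDl
      calc (⌈y ^ 2⌉₊ : ℝ) ^ 40 ≤ (2 * y ^ 2) ^ 40 := by gcongr
        _ = 2 ^ 40 * y ^ 80 := by ring
        _ ≤ δ * n / (16 * Q) := by
          rw [le_div_iff₀ (by positivity)]
          have h1 := hyQ.trans (hpow 20 (by norm_num))
          have h2 : (2 : ℝ) ^ 40 * (16 * Q) ≤ δ * y ^ 20 := by
            have : (2 : ℝ) ^ 40 * (16 * Q / δ) = (2 ^ 40 * (16 * Q)) / δ := by ring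
            rw [this, div_le_iff₀ hδ] at h1
            linarith
          rw [← hyn]
          have : 0 < y ^ 80 := by positivity
          calc 2 ^ 40 * y ^ 80 * (16 * Q) = (2 ^ 40 * (16 * Q)) * y ^ 80 := by ring
            _ ≤ (δ * y ^ 20) * y ^ 80 := by gcongr
            _ = δ * y ^ 100 := by ring
    exact_mod_cast this
  · have h1 : 4 * Q * (⌊δ * n / (8 * Q)⌋₊ : ℝ) ≤ 4 * Q * (δ * n / (8 * Q)) := by gcongr
    have h2 : 4 * Q * (δ * n / (8 * Q)) = δ * n / 2 := by field_simp; norm_num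
    have h3 : 2 ≤ δ * n := by
      have := hyd.trans hny
      rw [div_le_iff₀ hδ] at this
      linarith
    linarith
  · intro q hq hqQ
    have hqr : (0 : ℝ) < q := by exact_mod_cast hq
    have hqQr : (q : ℝ) ≤ Q := by exact_mod_cast hqQ
    have h1 : ((2 * n * q : ℕ) : ℝ) ^ ((1 : ℝ) + 1 / 100) ≤
        (2 * Q : ℝ) ^ ((1 : ℝ) + 1 / 100) * y ^ 101 := by
      have h2 : ((2 * n * q : ℕ) : ℝ) ≤ (2 * Q) * n := by
        push_cast
        nlinarith
      refine (Real.rpow_le_rpow (by positivity) h2 (by norm_num)).trans_eq ?_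
      rw [Real.mul_rpow (by positivity) (by positivity)]
      congr 1
      rw [hydef, ← Real.rpow_natCast, ← Real.rpow_mul hnp.le]
      norm_num
    have hpos : (0 : ℝ) < ((2 * n * q : ℕ) : ℝ) ^ ((1 : ℝ) + 1 / 100) := by
      push_cast; positivity
    calc 1 / (⌈y ^ 2⌉₊ : ℝ) ≤ 1 / y ^ 2 := by gcongr
      _ ≤ c1 / y := by
        rw [div_le_div_iff₀ (by positivity) hyp]
        rw [div_le_iff₀ hc1p] at hyc
        nlinarith
      _ = δ * n / (16 * Q) * (c / ((2 * Q : ℝ) ^ ((1 : ℝ) + 1 / 100) * y ^ 101)) := by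
        rw [hc1, ← hyn]
        field_simp
      _ ≤ _ := by
        gcongr

lemma core (α : ℝ)
    (hroth : ∀ ε : ℝ, 0 < ε → ∃ c : ℝ, 0 < c ∧ ∀ q : ℕ, 0 < q →
      c / (q : ℝ) ^ ((1 : ℝ) + ε) < distInt ((q : ℝ) * α))
    (lam a β γ δ : ℝ) (hlam : lam < 1 / 2) (hδ : 0 < δ) (F : ℤ → ℝ)
    (hF : ∀ n : ℤ, F n = Int.fract ((α * (n : ℝ) ^ 2 + β * n + γ) - a)) :
    ∃ n0 : ℕ, ∀ n : ℕ, n0 ≤ n → 0 < n ∧ ∀ m : ℕ,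
      (∀ k : ℕ, 1 ≤ k → k ≤ m → |F (k + n) - F k| ≤ lam) → (m : ℝ) ≤ δ * n := by
  obtain ⟨Q, hQ⟩ := exists_nat_gt (1 / (1 - 2 * lam))
  have hη : 0 < 1 - 2 * lam := by linarith
  have hQr : (0 : ℝ) < Q := lt_trans (by positivity) hQ
  have hQ0 : 0 < Q := by exact_mod_cast hQr
  obtain ⟨c, hc, hcr⟩ := hroth (1 / 100) (by norm_num)
  obtain ⟨M0, hM0⟩ := density α hroth Q
  obtain ⟨n0, hn0⟩ := asym c δ hc hδ Q M0 hQ0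
  refine ⟨n0, fun n hn => ?_⟩
  obtain ⟨hnp, M, D, hM, hMp, hMD, hDm, hDc⟩ := hn0 n hn
  refine ⟨hnp, fun m hm => ?_⟩
  by_contra hcon
  push Not at hcon
  obtain ⟨q, hq, hqQ, hqd⟩ := Real.exists_nat_abs_mul_sub_round_le (2 * n * α) hQ0
  set θ : ℝ := q * (2 * n * α) - round ((q : ℝ) * (2 * n * α)) with hθ
  have hθl : 1 / (M : ℝ) ≤ D * |θ| := by
    refine (hDc q hq hqQ).trans ?_
    gcongr
    refine (hcr (2 * n * q) (by positivity)).le.trans_eq ?_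
    rw [hθ]
    unfold distInt
    have : ((2 * n * q : ℕ) : ℝ) * α = q * (2 * n * α) := by push_cast; ring
    rw [this]
  have hθu : |θ| + 2 * lam < 1 := by
    have h1 : 1 / ((Q : ℝ) + 1) < 1 - 2 * lam := by
      rw [div_lt_iff₀ hη] at hQ
      rw [div_lt_iff₀ (by positivity)]
      nlinarith
    linarith
  have hmD : 1 + 4 * q * D ≤ m := by
    have h1 : (1 : ℝ) + 4 * q * D ≤ m := by
      have : (q : ℝ) ≤ Q := by exact_mod_cast hqQ
      have : 4 * (q : ℝ) * D ≤ 4 * Q * D := by gcongr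
      linarith
    exact_mod_cast h1
  -- the difference sequence along the progression
  set G : ℕ → ℝ := fun j => F ((1 + q * j : ℕ) + n) - F ((1 + q * j : ℕ)) with hG
  have hGb : ∀ j ≤ 4 * D, |G j| ≤ lam := by
    intro j hj
    refine hm (1 + q * j) (by omega) ?_
    have : q * j ≤ q * (4 * D) := Nat.mul_le_mul_left _ hj
    have e : q * (4 * D) = 4 * q * D := by ring
    omega
  have hstep : ∀ j < 4 * D, G (j + 1) = G j + θ := by
    intro j hj
    have h1 := hGb j hj.le
    have h2 := hGb (j + 1) hj
    have hint : ∃ z : ℤ, G (j + 1) - G j - θ = z := by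
      refine ⟨round ((q : ℝ) * (2 * n * α)) - (⌊α * (((1 + q * (j + 1) : ℕ) + n : ℤ) : ℝ) ^ 2 +
        β * (((1 + q * (j + 1) : ℕ) + n : ℤ) : ℝ) + γ - a⌋ - ⌊α * (((1 + q * (j + 1) : ℕ) : ℤ) : ℝ) ^ 2 +
        β * (((1 + q * (j + 1) : ℕ) : ℤ) : ℝ) + γ - a⌋ - ⌊α * (((1 + q * j : ℕ) + n : ℤ) : ℝ) ^ 2 +
        β * (((1 + q * j : ℕ) + n : ℤ) : ℝ) + γ - a⌋ + ⌊α * (((1 + q * j : ℕ) : ℤ) : ℝ) ^ 2 +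
        β * (((1 + q * j : ℕ) : ℤ) : ℝ) + γ - a⌋), ?_⟩
      simp only [hG, hF, hθ, Int.fract]
      push_cast
      ring
    obtain ⟨z, hz⟩ := hint
    have h3 : |(z : ℝ)| < 1 := by
      rw [← hz]
      rw [abs_le] at h1 h2
      have h4 := le_abs_self θ
      have h5 := neg_le_abs θ
      rw [abs_lt]
      constructor <;> linarith
    have h4 : z = 0 := by
      have : |z| < 1 := by exact_mod_cast h3
      exact Int.abs_lt_one_iff.mp this
    rw [h4] at hz
    push_cast at hz
    linarith
  have hlin : ∀ j ≤ 4 * D, G j = G 0 + j * θ := by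
    intro j
    induction j with
    | zero => intro _; simp
    | succ j ih =>
      intro hj
      rw [hstep j (by omega), ih (by omega)]
      push_cast
      ring
  have hFb : ∀ k, 0 ≤ F k ∧ F k < 1 := by
    intro k
    rw [hF]
    exact ⟨Int.fract_nonneg _, Int.fract_lt_one _⟩
  -- hitting lemma
  have hhit : ∀ j0 : ℕ, ∀ d : ℝ, ∃ j < D,
      Int.fract ((α * (((1 + q * (j0 + j) : ℕ) : ℤ) : ℝ) ^ 2 +
        β * (((1 + q * (j0 + j) : ℕ) : ℤ) : ℝ) + γ) - a + d) < 1 / M := by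
    intro j0 d
    obtain ⟨j, hj, hjf⟩ := hM0 M hM q hq hqQ (2 * α * q * (1 + q * j0) + β * q)
      (α * (1 + q * j0) ^ 2 + β * (1 + q * j0) + γ - a + d)
    refine ⟨j, by omega, ?_⟩
    convert hjf using 2
    push_cast
    ring
  have hMr : (0 : ℝ) < M := by exact_mod_cast hMp
  have hpos : ∀ j0 : ℕ, (∀ j < D, 1 / (M : ℝ) ≤ G (j0 + j)) → False := by
    intro j0 h
    obtain ⟨j, hj, hf⟩ := hhit j0 (1 / M)
    have h1 := h j hj
    have h2 := (hFb ((1 + q * (j0 + j) : ℕ) + n)).2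
    simp only [hG] at h1
    have h3 : F ((1 + q * (j0 + j) : ℕ)) < 1 - 1 / M := by linarith
    rw [hF] at h3
    set x := (α * (((1 + q * (j0 + j) : ℕ) : ℤ) : ℝ) ^ 2 +
        β * (((1 + q * (j0 + j) : ℕ) : ℤ) : ℝ) + γ) - a with hx
    have h0 := Int.fract_nonneg x
    have hw : (0 : ℝ) < 1 / M := by positivity
    have h4 : Int.fract (x + 1 / M) = Int.fract x + 1 / M := by
      rw [Int.fract_eq_iff]
      refine ⟨by linarith, by linarith, ⌊x⌋, ?_⟩
      have := Int.floor_add_fract x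
      linarith
    linarith
  have hneg : ∀ j0 : ℕ, (∀ j < D, G (j0 + j) ≤ -(1 / (M : ℝ))) → False := by
    intro j0 h
    obtain ⟨j, hj, hf⟩ := hhit j0 0
    have h1 := h j hj
    have h2 := (hFb ((1 + q * (j0 + j) : ℕ) + n)).1
    simp only [hG] at h1
    have h3 : 1 / M ≤ F ((1 + q * (j0 + j) : ℕ)) := by linarith
    rw [hF] at h3
    rw [add_zero] at hf
    linarith
  have hmul : ∀ (i : ℕ) (τ : ℝ), 0 ≤ τ → D ≤ i → D * τ ≤ i * τ := by
    intro i τ hτ hi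
    have : (D : ℝ) ≤ i := by exact_mod_cast hi
    gcongr
  have h2D := hlin (2 * D) (by omega)
  push_cast at h2D
  rcases le_total 0 θ with hs | hs
  · rw [abs_of_nonneg hs] at hθl
    rcases le_total 0 (G (2 * D)) with hg | hg
    · refine hpos (3 * D) fun j hj => ?_
      rw [hlin _ (by omega)]
      push_cast
      have : 0 ≤ (j : ℝ) * θ := by positivity
      linarith
    · refine hneg 0 fun j hj => ?_
      rw [hlin _ (by omega)]
      push_cast
      have : (j : ℝ) * θ ≤ D * θ := by
        have : (j : ℝ) ≤ D := by exact_mod_cast hj.le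
        gcongr
      linarith
  · rw [abs_of_nonpos hs] at hθl
    rcases le_total (G (2 * D)) 0 with hg | hg
    · refine hneg (3 * D) fun j hj => ?_
      rw [hlin _ (by omega)]
      push_cast
      have : 0 ≤ (j : ℝ) * (-θ) := mul_nonneg (by positivity) (by linarith)
      linarith
    · refine hpos 0 fun j hj => ?_
      rw [hlin _ (by omega)]
      push_cast
      have : (j : ℝ) * (-θ) ≤ D * (-θ) := by
        have : (j : ℝ) ≤ D := by exact_mod_cast hj.le
        exact mul_le_mul_of_nonneg_right this (by linarith)
      linarith

lemma Rn_bound {A : Type*} (ω : ℤ → A) (n : ℕ) (hn : 0 < n) (δ : ℝ) (hδ : 0 < δ)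
    (h : ∀ m : ℕ, (∀ k : ℕ, 1 ≤ k → k ≤ m → ω (k : ℤ) = ω ((k : ℤ) + n)) → (m : ℝ) ≤ δ * n) :
    Rn ω n ≤ 1 + ENNReal.ofReal δ := by
  unfold Rn
  gcongr
  have hsup : sSup ((fun m : ℕ => (m : ℝ≥0∞)) ''
      {m : ℕ | ∀ k : ℕ, 1 ≤ k → k ≤ m → ω (k : ℤ) = ω ((k : ℤ) + n)}) ≤
      n * ENNReal.ofReal δ := by
    apply sSup_le
    rintro _ ⟨m, hm, rfl⟩
    have h1 := h m hm
    simp only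
    rw [← ENNReal.ofReal_natCast, ← ENNReal.ofReal_natCast,
      ← ENNReal.ofReal_mul (by positivity)]
    apply ENNReal.ofReal_le_ofReal
    linarith
  calc _ ≤ (n : ℝ≥0∞)⁻¹ * (n * ENNReal.ofReal δ) := by gcongr
    _ = ENNReal.ofReal δ := by
      rw [← mul_assoc, ENNReal.inv_mul_cancel (by exact_mod_cast hn.ne') (by simp), one_mul]

lemma Tn_le_Rn {A : Type*} (ω : ℤ → A) (n : ℕ) : Tn ω n ≤ Rn ω n := by
  unfold Tn Rn
  refine add_le_add_right (mul_le_mul_right (sSup_le_sSup (Set.image_mono ?_)) _) _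
  intro m hm k h1 h2
  exact (hm k h1 h2).1

lemma one_le_TRep {A : Type*} (ω : ℤ → A) : 1 ≤ TRep ω := by
  unfold TRep
  refine Filter.le_limsup_of_frequently_le ?_ (by isBoundedDefault)
  refine Filter.Frequently.of_forall fun n => ?_
  unfold Tn
  exact le_self_add

lemma arc_exists (N : ℕ) (t : ℕ → ℝ) (x : ℝ) (h0 : t 0 ≤ x) (hx : x < t N) :
    ∃ l < N, x ∈ Set.Ico (t l) (t (l + 1)) := by
  induction N with
  | zero => exact absurd hx (not_lt.mpr h0)
  | succ N ih =>
    rcases lt_or_ge x (t N) with h | h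
    · obtain ⟨l, hl, hm⟩ := ih h
      exact ⟨l, by omega, hm⟩
    · exact ⟨N, by omega, h, hx⟩

/-- If `α` is a Roth number and each arc of the finite interval
partition of `ℝ/ℤ` has length `< 1/2`, then the coding of `n ↦ αn² + βn + γ`
has no pinned repetitions: `R(s) = T(s) = 1`.  The partition is given by an
offset `a` and cut points `t 0 = 0 < t 1 < ⋯ < t N = 1`; the arcs are
`{x : t l ≤ fract (x - a) < t (l+1)}` for `0 ≤ l < N`. -/
theorem no_repetitions_roth_number
    (α : ℝ) (hα : Irrational α)
    (hroth : ∀ ε : ℝ, 0 < ε → ∃ c : ℝ, 0 < c ∧ ∀ q : ℕ, 0 < q → c / (q : ℝ) ^ ((1 : ℝ) + ε) < distInt ((q : ℝ) * α))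
    (N : ℕ) (hN : 0 < N) (a : ℝ) (t : ℕ → ℝ)
    (ht0 : t 0 = 0) (htN : t N = 1)
    (hmono : ∀ l < N, t l < t (l + 1))
    (hlen : ∀ l < N, t (l + 1) - t l < 1 / 2)
    (β γ : ℝ) (s : ℤ → ℕ)
    (hs : ∀ n : ℤ, ∀ l < N,
      (s n = l ↔ Int.fract ((α * (n : ℝ) ^ 2 + β * n + γ) - a) ∈ Set.Ico (t l) (t (l + 1)))) :
    RRep s = 1 ∧ TRep s = 1 := by
  -- a uniform bound for the arc lengths
  obtain ⟨lam, hlam, hlam2⟩ : ∃ lam : ℝ, lam < 1 / 2 ∧ ∀ l < N, t (l + 1) - t l ≤ lam := by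
    obtain ⟨l0, hl0, hmax⟩ := Finset.exists_max_image (Finset.range N)
      (fun l => t (l + 1) - t l) ⟨0, by simpa using hN⟩
    exact ⟨_, hlen l0 (by simpa using hl0), fun l hl => hmax l (by simpa using hl)⟩
  have hclose : ∀ p r : ℤ, s p = s r →
      |Int.fract ((α * (r : ℝ) ^ 2 + β * r + γ) - a) -
        Int.fract ((α * (p : ℝ) ^ 2 + β * p + γ) - a)| ≤ lam := by
    intro p r hpr
    obtain ⟨l, hl, hm⟩ := arc_exists N t (Int.fract ((α * (p : ℝ) ^ 2 + β * p + γ) - a))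
      (by rw [ht0]; exact Int.fract_nonneg _) (by rw [htN]; exact Int.fract_lt_one _)
    have h1 := (hs p l hl).mpr hm
    have h2 := (hs r l hl).mp (hpr ▸ h1)
    have h3 := hlam2 l hl
    rw [abs_le]
    constructor <;> linarith [hm.1, hm.2, h2.1, h2.2]
  have hR : RRep s ≤ 1 := by
    refine ENNReal.le_of_forall_pos_le_add fun δ hδ _ => ?_
    obtain ⟨n0, hn0⟩ := core α hroth lam a β γ δ hlam (by exact_mod_cast hδ)
      (fun n : ℤ => Int.fract ((α * (n : ℝ) ^ 2 + β * n + γ) - a)) (fun _ => rfl)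
    unfold RRep
    refine Filter.limsup_le_of_le (by isBoundedDefault) ?_
    filter_upwards [Filter.eventually_ge_atTop n0] with n hn
    obtain ⟨hnp, hm⟩ := hn0 n hn
    have := Rn_bound s n hnp δ (by exact_mod_cast hδ)
      (fun m hk => hm m fun k hk1 hk2 => hclose _ _ (hk k hk1 hk2))
    simpa using this
  have hTR : TRep s ≤ RRep s :=
    Filter.limsup_le_limsup (Filter.Eventually.of_forall fun n => Tn_le_Rn s n)
  have h1 := one_le_TRep s
  exact ⟨le_antisymm hR (h1.trans hTR), le_antisymm (hTR.trans hR) h1⟩
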